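/- Let q ≥ 1, α ∈ ℝ, n ∈ ℕ₀, and (s_j)_{j=0}^{2n} ∈ K≥,e_{α,q,2n}; write T := T_{q,n}, v := v_{q,n}, I := I_{(n+1)q}. Define U_{n,α} : ℂ → ℂ^{2q×2q} by U_{n,α}(ζ) := I_{2q} + (ζ−α)·(I₂⊗v)*·[T·H_n, −I]*·R_{T*}(ζ)·H_n^⊐·R_T(α)·[I, T·H_n]·(I₂⊗v). Then for all z, w ∈ ℂ: J̃_q − U_{n,α}(z)·J̃_q·U_{n,α}(w)* = −i·(z − conj(w))·(I₂⊗v)*·[T·H_n, −I]*·R_{T*}(z)·H_n^⊐·(R_{T*}(w))*·[T·H_n, −I]·(I₂⊗v). -/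

import Mathlib

open Matrix ComplexConjugate
open scoped ComplexOrder

noncomputable section

/-- The block Hankel matrix `H_n = [s_{j+k}]_{j,k=0}^n`. -/
def hank (q n : ℕ) (s : ℕ → Matrix (Fin q) (Fin q) ℂ) :
    Matrix (Fin (n + 1) × Fin q) (Fin (n + 1) × Fin q) ℂ :=
  Matrix.of fun j k => s (j.1.val + k.1.val) j.2 k.2

/-- The right-sided `α`-shifted sequence `s_{α▷j} = -α·s_j + s_{j+1}`. -/
def sShift {q : ℕ} (α : ℝ) (s : ℕ → Matrix (Fin q) (Fin q) ℂ) :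
    ℕ → Matrix (Fin q) (Fin q) ℂ :=
  fun j => (-(α : ℂ)) • s j + s (j + 1)

/-- The block shift `T_{q,n} = [δ_{j,k+1}·I_q]_{j,k=0}^n`. -/
def bshift (q n : ℕ) : Matrix (Fin (n + 1) × Fin q) (Fin (n + 1) × Fin q) ℂ :=
  Matrix.of fun j k => if j.1.val = k.1.val + 1 ∧ j.2 = k.2 then (1 : ℂ) else 0

/-- `v_{q,n} = col(δ_{j,0}·I_q)_{j=0}^n`. -/
def vq (q n : ℕ) : Matrix (Fin (n + 1) × Fin q) (Fin q) ℂ :=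
  Matrix.of fun j b => if j.1.val = 0 ∧ j.2 = b then (1 : ℂ) else 0

/-- `u_n = -col(s_{j-1})_{j=0}^n` with `s_{-1} = 0`. -/
def uq (q n : ℕ) (s : ℕ → Matrix (Fin q) (Fin q) ℂ) :
    Matrix (Fin (n + 1) × Fin q) (Fin q) ℂ :=
  Matrix.of fun j b => if j.1.val = 0 then 0 else -s (j.1.val - 1) j.2 b

/-- `y_{0,n} = col(s_j)_{j=0}^n`. -/
def yq (q n : ℕ) (s : ℕ → Matrix (Fin q) (Fin q) ℂ) :
    Matrix (Fin (n + 1) × Fin q) (Fin q) ℂ :=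
  Matrix.of fun j b => s j.1.val j.2 b

/-- `R_T(z) = (I - z·T_{q,n})⁻¹`. -/
def RT (q n : ℕ) (z : ℂ) : Matrix (Fin (n + 1) × Fin q) (Fin (n + 1) × Fin q) ℂ :=
  (1 - z • bshift q n)⁻¹

/-- `R_{T*}(z) = (I - z·T_{q,n}*)⁻¹`. -/
def RTs (q n : ℕ) (z : ℂ) : Matrix (Fin (n + 1) × Fin q) (Fin (n + 1) × Fin q) ℂ :=
  (1 - z • (bshift q n)ᴴ)⁻¹

open scoped Classical in
/-- The Moore–Penrose inverse of a complex matrix (it exists and is unique,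
so the `dite` below always takes its first branch and picks it out). -/
def mp {m n : Type*} [Fintype m] [Fintype n] (A : Matrix m n ℂ) : Matrix n m ℂ :=
  if h : ∃ X : Matrix n m ℂ,
      A * X * A = A ∧ X * A * X = X ∧ (A * X)ᴴ = A * X ∧ (X * A)ᴴ = X * A
  then h.choose else 0

/-- The Schur complements `L_0 = s_0` and
`L_j = s_{2j} - z_{j,2j-1}·(H_{j-1})^†·y_{j,2j-1}` for `j ≥ 1`. -/
def LS (q : ℕ) (s : ℕ → Matrix (Fin q) (Fin q) ℂ) : ℕ → Matrix (Fin q) (Fin q) ℂ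
  | 0 => s 0
  | n + 1 =>
      s (2 * (n + 1)) -
        (Matrix.of fun (a : Fin q) (j : Fin (n + 1) × Fin q) => s ((n + 1) + j.1.val) a j.2) *
          mp (hank q n s) *
          (Matrix.of fun (j : Fin (n + 1) × Fin q) (b : Fin q) => s ((n + 1) + j.1.val) j.2 b)

/-- The block diagonal matrix `diag(L_0, …, L_n)`. -/
def Ldiag (q n : ℕ) (s : ℕ → Matrix (Fin q) (Fin q) ℂ) :
    Matrix (Fin (n + 1) × Fin q) (Fin (n + 1) × Fin q) ℂ :=
  Matrix.of fun j k => if j.1 = k.1 then LS q s j.1.val j.2 k.2 else 0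

/-- The subspace `D_n = range(diag(L_0, …, L_n)) ⊆ ℂ^{(n+1)q}`. -/
def Dsub (q n : ℕ) (s : ℕ → Matrix (Fin q) (Fin q) ℂ) :
    Submodule ℂ (Fin (n + 1) × Fin q → ℂ) :=
  LinearMap.range (Matrix.mulVecLin (Ldiag q n s))

/-- `V_{q,n+1} = [δ_{j,k}·I_q]`, embedding `ℂ^{(n+1)q}` into the first `n+1` block
components of `ℂ^{(n+2)q}` (defined here with `n+1` block columns). -/
def embV (q n : ℕ) : Matrix (Fin (n + 1) × Fin q) (Fin n × Fin q) ℂ :=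
  Matrix.of fun j k => if j.1.val = k.1.val ∧ j.2 = k.2 then (1 : ℂ) else 0

/-- `𝔙_{q,n+1} = [δ_{j,k+1}·I_q]`, embedding `ℂ^{(n+1)q}` into the last `n+1` block
components of `ℂ^{(n+2)q}` (defined here with `n+1` block columns). -/
def embW (q n : ℕ) : Matrix (Fin (n + 1) × Fin q) (Fin n × Fin q) ℂ :=
  Matrix.of fun j k => if j.1.val = k.1.val + 1 ∧ j.2 = k.2 then (1 : ℂ) else 0

end

/-- `G` is the generalized inverse `H_D^⊐` of a Hermitian matrix `H` associated with a
subspace `D`: `HGH = H`, `GHG = G`, `range G = D` and `ker G = D^⊥`. -/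
def IsRGI {ι : Type*} [Fintype ι] (H G : Matrix ι ι ℂ) (D : Submodule ℂ (ι → ℂ)) : Prop :=
  H * G * H = H ∧ G * H * G = G ∧
    LinearMap.range (Matrix.mulVecLin G) = D ∧
    ∀ x : ι → ℂ, Matrix.mulVec G x = 0 ↔ ∀ y ∈ D, dotProduct (star y) x = 0

noncomputable section

/-- The signature matrix `J̃_q = [[0, -i·I_q], [i·I_q, 0]]`. -/
def Jmat (q : ℕ) : Matrix (Fin q ⊕ Fin q) (Fin q ⊕ Fin q) ℂ :=
  Matrix.fromBlocks 0 ((-Complex.I) • (1 : Matrix (Fin q) (Fin q) ℂ))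
    (Complex.I • (1 : Matrix (Fin q) (Fin q) ℂ)) 0

/-- `I₂ ⊗ v_{q,n} = diag(v_{q,n}, v_{q,n})`. -/
def kvq (q n : ℕ) :
    Matrix ((Fin (n + 1) × Fin q) ⊕ (Fin (n + 1) × Fin q)) (Fin q ⊕ Fin q) ℂ :=
  Matrix.fromBlocks (vq q n) 0 0 (vq q n)

end

noncomputable section

/-- The matrix polynomial `U_{n,α}(ζ)` built from `H_n^⊐ = G`. -/
def Umat (q n : ℕ) (α : ℝ) (s : ℕ → Matrix (Fin q) (Fin q) ℂ)
    (G : Matrix (Fin (n + 1) × Fin q) (Fin (n + 1) × Fin q) ℂ) (ζ : ℂ) :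
    Matrix (Fin q ⊕ Fin q) (Fin q ⊕ Fin q) ℂ :=
  1 + (ζ - (α : ℂ)) •
    ((kvq q n)ᴴ *
      (Matrix.fromCols (bshift q n * hank q n s)
        (-1 : Matrix (Fin (n + 1) × Fin q) (Fin (n + 1) × Fin q) ℂ))ᴴ * RTs q n ζ * G *
      RT q n (α : ℂ) *
      Matrix.fromCols (1 : Matrix (Fin (n + 1) × Fin q) (Fin (n + 1) × Fin q) ℂ)
        (bshift q n * hank q n s) * kvq q n)

end

theorem aux_shift_pow (q n m : ℕ) (j k : Fin (n+1) × Fin q) (h : (bshift q n ^ m) j k ≠ 0) :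
    j.1.val = k.1.val + m := by
  induction m generalizing j with
  | zero =>
    by_contra hc
    apply h
    rw [pow_zero, Matrix.one_apply_ne]
    rintro rfl
    simp at hc
  | succ m ih =>
    rw [pow_succ', Matrix.mul_apply] at h
    obtain ⟨l, -, hl⟩ := Finset.exists_ne_zero_of_sum_ne_zero h
    have h1 := ih l (right_ne_zero_of_mul hl)
    have h2 := left_ne_zero_of_mul hl
    simp only [bshift, Matrix.of_apply] at h2
    have := (ite_ne_right_iff.mp h2).1.1
    omega

theorem aux_nilp (q n : ℕ) : IsNilpotent (bshift q n) := by
  refine ⟨n+1, ?_⟩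
  ext j k
  by_contra h
  have := aux_shift_pow q n (n+1) j k h
  have := j.1.isLt
  omega

theorem aux_unit (q n : ℕ) (z : ℂ) : IsUnit (1 - z • bshift q n) := by
  apply IsNilpotent.isUnit_one_sub
  exact (aux_nilp q n).smul z

theorem aux_RTs (q n : ℕ) (z : ℂ) : (RTs q n z)ᴴ = RT q n (conj z) := by
  simp [RTs, RT, Matrix.conjTranspose_nonsing_inv]

theorem aux_RT_l (q n : ℕ) (z : ℂ) : RT q n z * (1 - z • bshift q n) = 1 :=
  Matrix.nonsing_inv_mul _ ((Matrix.isUnit_iff_isUnit_det _).mp (aux_unit q n z))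

theorem aux_RT_r (q n : ℕ) (z : ℂ) : (1 - z • bshift q n) * RT q n z = 1 :=
  Matrix.mul_nonsing_inv _ ((Matrix.isUnit_iff_isUnit_det _).mp (aux_unit q n z))

theorem aux_RTs_l (q n : ℕ) (z : ℂ) : RTs q n z * (1 - z • (bshift q n)ᴴ) = 1 := by
  have h := congrArg Matrix.conjTranspose (aux_RT_r q n (conj z))
  rw [← aux_RTs, Matrix.conjTranspose_mul, Matrix.conjTranspose_conjTranspose] at h
  simpa using h

theorem aux_herm {ι : Type*} [Fintype ι] [DecidableEq ι] (H G : Matrix ι ι ℂ)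
    (D : Submodule ℂ (ι → ℂ)) (hH : Hᴴ = H) (hG : IsRGI H G D) : Gᴴ = G := by
  obtain ⟨h1, h2, h3, h4⟩ := hG
  have h2' : Gᴴ * H * Gᴴ = Gᴴ := by
    have := congrArg Matrix.conjTranspose h2
    simpa [Matrix.conjTranspose_mul, hH, Matrix.mul_assoc] using this
  have key : G * (1 - H * Gᴴ) = 0 := by
    apply Matrix.toLin'.injective
    ext1 x
    apply LinearMap.ext
    intro c
    simp only [LinearMap.comp_apply, Matrix.toLin'_apply, map_zero, LinearMap.zero_apply]
    rw [← Matrix.mulVec_mulVec, h4]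
    intro y hy
    rw [← h3] at hy
    obtain ⟨u, rfl⟩ := hy
    rw [Matrix.mulVecLin_apply, Matrix.star_mulVec, ← Matrix.dotProduct_mulVec,
      Matrix.mulVec_mulVec, Matrix.mul_sub, ← Matrix.mul_assoc, h2', Matrix.mul_one, sub_self,
      Matrix.zero_mulVec, dotProduct_zero]
  have e : G = G * H * Gᴴ := by
    rw [Matrix.mul_sub, Matrix.mul_one, sub_eq_zero, ← Matrix.mul_assoc] at key
    exact key
  have e2 := congrArg Matrix.conjTranspose e
  rw [Matrix.conjTranspose_mul, Matrix.conjTranspose_mul, hH, Matrix.conjTranspose_conjTranspose,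
    ← Matrix.mul_assoc, ← e] at e2
  exact e2

theorem aux_mp {ι : Type*} [Fintype ι] [DecidableEq ι] (A : Matrix ι ι ℂ) (hA : A.IsHermitian) :
    A * mp A * A = A := by
  have hex : ∃ X : Matrix ι ι ℂ,
      A * X * A = A ∧ X * A * X = X ∧ (A * X)ᴴ = A * X ∧ (X * A)ᴴ = X * A := by
    obtain ⟨U, d, h1, h2⟩ : ∃ (U : Matrix ι ι ℂ) (d : ι → ℝ), Uᴴ * U = 1 ∧
        A = U * diagonal (fun i => (d i : ℂ)) * Uᴴ := by
      refine ⟨hA.eigenvectorUnitary, hA.eigenvalues, ?_, ?_⟩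
      · exact Unitary.coe_star_mul_self hA.eigenvectorUnitary
      · exact hA.spectral_theorem
    have hm : ∀ X Y : Matrix ι ι ℂ, (U * X * Uᴴ) * (U * Y * Uᴴ) = U * (X * Y) * Uᴴ := by
      intro X Y
      calc _ = U * X * (Uᴴ * U) * Y * Uᴴ := by noncomm_ring
        _ = _ := by rw [h1]; noncomm_ring
    have hd : ∀ x : ℝ, (x : ℂ) * (x : ℂ)⁻¹ * x = x := by
      intro x
      by_cases h : (x : ℂ) = 0 <;> simp [h]
    have hd' : ∀ x : ℝ, (x : ℂ)⁻¹ * (x : ℂ) * (x : ℂ)⁻¹ = (x : ℂ)⁻¹ := by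
      intro x
      by_cases h : (x : ℂ) = 0 <;> simp [h]
    refine ⟨U * diagonal (fun i => ((d i : ℂ))⁻¹) * Uᴴ, ?_, ?_, ?_, ?_⟩
    · rw [h2]; simp only [hm, diagonal_mul_diagonal, hd]
    · rw [h2]; simp only [hm, diagonal_mul_diagonal, hd']
    · rw [h2, hm]
      simp only [diagonal_mul_diagonal, conjTranspose_mul, conjTranspose_conjTranspose,
        diagonal_conjTranspose, Matrix.mul_assoc]
      congr 3; ext i; simp
    · rw [h2, hm]
      simp only [diagonal_mul_diagonal, conjTranspose_mul, conjTranspose_conjTranspose,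
        diagonal_conjTranspose, Matrix.mul_assoc]
      congr 3; ext i; simp
  unfold mp
  rw [dif_pos hex]
  exact hex.choose_spec.1

theorem aux_psd {ι : Type*} [Fintype ι] (A : Matrix ι ι ℂ) (hA : A.PosSemidef)
    (x : ι → ℂ) (h : star x ⬝ᵥ (A *ᵥ x) = 0) : A *ᵥ x = 0 := by
  classical
  exact (hA.dotProduct_mulVec_zero_iff x).mp h

theorem aux_Tmul {κ : Type*} (q n : ℕ) (M : Matrix (Fin (n+1) × Fin q) κ ℂ)
    (j : Fin (n+1)) (b : Fin q) (k : κ) :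
    (bshift q n * M) (j, b) k =
      if j.val = 0 then 0 else M (⟨j.val - 1, by omega⟩, b) k := by
  rw [Matrix.mul_apply]
  split_ifs with h
  · apply Finset.sum_eq_zero
    rintro ⟨l, c⟩ -
    simp [bshift, h]
  · rw [Finset.sum_eq_single (⟨j.val - 1, by omega⟩, b)]
    · simp only [bshift, Matrix.of_apply]
      rw [if_pos ⟨by omega, trivial⟩, one_mul]
    · rintro ⟨l, c⟩ - hne
      simp only [bshift, Matrix.of_apply]
      rw [if_neg, zero_mul]
      rintro ⟨h1, rfl⟩
      apply hne
      ext <;> simp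
      omega
    · simp

theorem aux_Tvec (q n : ℕ) (u : Fin (n+1) × Fin q → ℂ) (j : Fin (n+1)) (b : Fin q) :
    (bshift q n *ᵥ u) (j, b) = if j.val = 0 then 0 else u (⟨j.val - 1, by omega⟩, b) := by
  have := aux_Tmul q n (Matrix.of fun i (_ : Unit) => u i) j b ()
  simpa [Matrix.mul_apply, Matrix.mulVec, dotProduct] using this

theorem aux_mulTs {κ : Type*} (q n : ℕ) (M : Matrix κ (Fin (n+1) × Fin q) ℂ)
    (j : Fin (n+1)) (b : Fin q) (k : κ) :
    (M * (bshift q n)ᴴ) k (j, b) =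
      if j.val = 0 then 0 else M k (⟨j.val - 1, by omega⟩, b) := by
  have e : M * (bshift q n)ᴴ = (bshift q n * Mᴴ)ᴴ := by simp
  rw [e, Matrix.conjTranspose_apply, aux_Tmul]
  split_ifs <;> simp

theorem aux_mulv {κ : Type*} (q n : ℕ) (M : Matrix κ (Fin (n+1) × Fin q) ℂ) (k : κ) (b : Fin q) :
    (M * vq q n) k b = M k (0, b) := by
  rw [Matrix.mul_apply, Finset.sum_eq_single (0, b)]
  · simp [vq]
  · rintro ⟨l, c⟩ - hne
    simp only [vq, Matrix.of_apply]
    rw [if_neg, mul_zero]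
    rintro ⟨h1, rfl⟩
    apply hne
    ext <;> simp [h1]
  · simp

theorem aux_mulvs {κ : Type*} (q n : ℕ) (M : Matrix κ (Fin q) ℂ) (k : κ)
    (j : Fin (n+1)) (b : Fin q) :
    (M * (vq q n)ᴴ) k (j, b) = if j.val = 0 then M k b else 0 := by
  rw [Matrix.mul_apply]
  simp only [vq, Matrix.conjTranspose_apply, Matrix.of_apply]
  split_ifs with h
  · rw [Finset.sum_eq_single b] <;> simp [h]
    intro c hc h2
    exact absurd h2.symm hc
  · simp [h]

theorem aux_vmul {κ : Type*} (q n : ℕ) (M : Matrix (Fin q) κ ℂ) (k : κ)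
    (j : Fin (n+1)) (b : Fin q) :
    (vq q n * M) (j, b) k = if j.val = 0 then M b k else 0 := by
  have e : vq q n * M = (Mᴴ * (vq q n)ᴴ)ᴴ := by simp
  rw [e, Matrix.conjTranspose_apply, aux_mulvs]
  split_ifs <;> simp

theorem aux_vsmul {κ : Type*} (q n : ℕ) (M : Matrix (Fin (n+1) × Fin q) κ ℂ) (k : κ) (b : Fin q) :
    ((vq q n)ᴴ * M) b k = M (0, b) k := by
  have e : (vq q n)ᴴ * M = (Mᴴ * vq q n)ᴴ := by simp
  rw [e, Matrix.conjTranspose_apply, aux_mulv]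
  simp

theorem aux_lyap (q n : ℕ) (s : ℕ → Matrix (Fin q) (Fin q) ℂ) :
    bshift q n * hank q n s - hank q n s * (bshift q n)ᴴ
     = bshift q n * hank q n s * vq q n * (vq q n)ᴴ
       - vq q n * ((vq q n)ᴴ * (hank q n s * (bshift q n)ᴴ)) := by
  ext ⟨j, b⟩ ⟨k, c⟩
  simp only [Matrix.sub_apply, aux_Tmul, aux_mulTs, aux_mulvs, aux_mulv, aux_vmul, aux_vsmul, hank,
    Matrix.of_apply]
  by_cases hj : j.val = 0 <;> by_cases hk : k.val = 0 <;> simp [hj, hk]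
  rw [show j.val - 1 + k.val = j.val + (k.val - 1) by omega, sub_self]

theorem aux_core {ι : Type*} [Fintype ι] [DecidableEq ι] (T H G R Rs Rz Rw S Ss : Matrix ι ι ℂ)
    (a z w : ℂ) (hRz : Rz * (1 - z • Tᴴ) = 1) (hRw : (1 - w • T) * Rw = 1)
    (hR1 : R * (1 - a • T) = 1) (hR2 : (1 - a • Tᴴ) * Rs = 1)
    (hS : S = R * T) (hSs : Ss = Tᴴ * Rs)
    (h1 : G * S * H * G = G * S) (h2 : G * H * Ss * G = Ss * G) :
    -((z - a) • (Rz * G * R)) + (w - a) • (Rs * G * Rw)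
      - ((z - a) • (Rz * G * R)) * (T * H - H * Tᴴ) * ((w - a) • (Rs * G * Rw))
     = -((z - w) • (Rz * G * Rw)) := by
  have e1 : R = 1 + a • S := by
    rw [hS]; rw [Matrix.mul_sub, Matrix.mul_one, Matrix.mul_smul] at hR1
    exact sub_eq_iff_eq_add.mp hR1
  have e2 : Rs = 1 + a • Ss := by
    rw [hSs]; rw [Matrix.sub_mul, Matrix.one_mul, Matrix.smul_mul] at hR2
    exact sub_eq_iff_eq_add.mp hR2
  have f1 : R * (1 - w • T) = 1 - (w - a) • S := by
    rw [Matrix.mul_sub, Matrix.mul_smul, ← hS, e1]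
    simp only [Matrix.mul_one]; module
  have f2 : (1 - z • Tᴴ) * Rs = 1 - (z - a) • Ss := by
    rw [Matrix.sub_mul, Matrix.smul_mul, ← hSs, e2]
    simp only [Matrix.one_mul]; module
  have f3 : R * (T * H - H * Tᴴ) * Rs = S * H - H * Ss := by
    calc _ = (R * T) * H * Rs - R * H * (Tᴴ * Rs) := by noncomm_ring
      _ = S * H * (1 + a • Ss) - (1 + a • S) * H * Ss := by rw [← hS, ← hSs, e1, e2]
      _ = _ := by
        simp only [Matrix.mul_add, Matrix.add_mul, Matrix.mul_smul, Matrix.smul_mul, Matrix.mul_one,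
          Matrix.one_mul]
        abel
  have g1 : Rz * G * R = Rz * (G * (R * (1 - w • T))) * Rw := by
    calc _ = Rz * G * R * ((1 - w • T) * Rw) := by rw [hRw, Matrix.mul_one]
      _ = _ := by simp only [Matrix.mul_assoc]
  have g2 : Rs * G * Rw = Rz * (((1 - z • Tᴴ) * Rs) * G) * Rw := by
    calc _ = (Rz * (1 - z • Tᴴ)) * Rs * G * Rw := by rw [hRz, Matrix.one_mul]
      _ = _ := by simp only [Matrix.mul_assoc]
  have g3 : ((z - a) • (Rz * G * R)) * (T * H - H * Tᴴ) * ((w - a) • (Rs * G * Rw))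
      = ((z - a) * (w - a)) • (Rz * (G * S - Ss * G) * Rw) := by
    rw [Matrix.smul_mul, Matrix.smul_mul, Matrix.mul_smul, smul_smul]
    congr 1
    calc _ = Rz * (G * (R * (T * H - H * Tᴴ) * Rs) * G) * Rw := by simp only [Matrix.mul_assoc]
      _ = Rz * (G * S * H * G - G * H * Ss * G) * Rw := by
        rw [f3]; congr 2; noncomm_ring
      _ = _ := by rw [h1, h2]
  rw [g3, g1, g2, f1, f2]
  simp only [Matrix.mul_sub, Matrix.sub_mul, Matrix.mul_smul, Matrix.smul_mul, Matrix.mul_one,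
          Matrix.one_mul]
  module

theorem aux_sub {ι κ : Type*} [Fintype ι] [Fintype κ] (H : Matrix ι ι ℂ) (e : κ → ι)
    (he : Function.Injective e) (u : ι → ℂ) (hu : ∀ i, i ∉ Set.range e → u i = 0) :
    (H.submatrix e e) *ᵥ (u ∘ e) = (H *ᵥ u) ∘ e := by
  funext k
  simp only [Matrix.mulVec, dotProduct, Function.comp_apply, Matrix.submatrix_apply]
  apply Fintype.sum_of_injective e he
  · intro i hi; rw [hu i hi, mul_zero]
  · intro i; rfl

theorem aux_sub_ker {ι κ : Type*} [Fintype ι] [Fintype κ] (H : Matrix ι ι ℂ)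
    (hH : H.PosSemidef) (e : κ → ι)
    (he : Function.Injective e) (u : ι → ℂ) (hu : ∀ i, i ∉ Set.range e → u i = 0) :
    (H.submatrix e e) *ᵥ (u ∘ e) = 0 ↔ H *ᵥ u = 0 := by
  rw [aux_sub H e he u hu]
  constructor
  · intro h
    apply aux_psd H hH
    have : star u ⬝ᵥ (H *ᵥ u) = star (u ∘ e) ⬝ᵥ ((H *ᵥ u) ∘ e) := by
      simp only [dotProduct]
      symm
      apply Fintype.sum_of_injective e he
      · intro i hi; simp [hu i hi]
      · intro i; rfl
    rw [this, h, dotProduct_zero]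
  · intro h
    rw [h]; rfl

theorem aux_schur {ι κ : Type*} [Fintype ι] [DecidableEq ι] [Fintype κ] [DecidableEq κ]
    (A : Matrix ι ι ℂ) (B : Matrix ι κ ℂ) (C : Matrix κ ι ℂ) (D : Matrix κ κ ℂ)
    (h : (Matrix.fromBlocks A B C D).PosSemidef) :
    (D - C * mp A * B)ᴴ = D - C * mp A * B ∧
    ∀ x : κ → ℂ, (D - C * mp A * B) *ᵥ x = 0 ↔
      ∃ a : ι → ℂ, Matrix.fromBlocks A B C D *ᵥ (Sum.elim a x) = 0 := by
  have hh := h.isHermitian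
  rw [Matrix.isHermitian_fromBlocks_iff] at hh
  obtain ⟨hA, hB, hC, hD⟩ := hh
  have hX := aux_mp A hA
  generalize mp A = X at *
  have hX' : A * Xᴴ * A = A := by
    have := congrArg Matrix.conjTranspose hX
    simpa [Matrix.conjTranspose_mul, hA.eq, Matrix.mul_assoc] using this
  have hker : ∀ a : ι → ℂ, A *ᵥ a = 0 → C *ᵥ a = 0 := by
    intro a ha
    have := aux_psd _ h (Sum.elim a 0) (by
      rw [Matrix.fromBlocks_mulVec]
      simp [ha, dotProduct, Fintype.sum_sum_type])
    rw [Matrix.fromBlocks_mulVec] at this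
    funext i
    have := congrFun this (Sum.inr i)
    simpa using this
  have hC1 : ∀ Y : Matrix ι ι ℂ, A * Y * A = A → C * Y * A = C := by
    intro Y hY
    have : C - C * Y * A = 0 := by
      apply Matrix.toLin'.injective
      apply LinearMap.ext
      intro c
      rw [Matrix.toLin'_apply, map_zero, LinearMap.zero_apply]
      have := hker ((1 - Y * A) *ᵥ c) (by
        rw [Matrix.mulVec_mulVec, Matrix.mul_sub, ← Matrix.mul_assoc, hY]; simp)
      rw [Matrix.mulVec_mulVec, Matrix.mul_sub, ← Matrix.mul_assoc, Matrix.mul_one] at this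
      exact this
    exact (sub_eq_zero.mp this).symm
  have c1 := hC1 X hX
  have c2 := hC1 Xᴴ hX'
  have b1 : A * X * B = B := by
    have := congrArg Matrix.conjTranspose c2
    simpa [Matrix.conjTranspose_mul, hA.eq, hC, Matrix.mul_assoc] using this
  refine ⟨?_, ?_⟩
  · rw [Matrix.conjTranspose_sub, hD.eq, Matrix.conjTranspose_mul, Matrix.conjTranspose_mul, hB, hC]
    congr 1
    calc C * (Xᴴ * B) = C * Xᴴ * (A * X * B) := by rw [b1, Matrix.mul_assoc]
      _ = (C * Xᴴ * A) * X * B := by simp only [Matrix.mul_assoc]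
      _ = _ := by rw [c2]
  · intro x
    constructor
    · intro hx
      refine ⟨-((X * B) *ᵥ x), ?_⟩
      rw [Matrix.fromBlocks_mulVec]
      simp only [Sum.elim_comp_inl, Sum.elim_comp_inr, Matrix.mulVec_neg, Matrix.mulVec_mulVec,
        ← Matrix.mul_assoc, b1]
      rw [Matrix.sub_mulVec] at hx
      funext i
      cases i with
      | inl i => simp
      | inr i => simpa [sub_eq_neg_add] using congrFun hx i
    · rintro ⟨a, ha⟩
      rw [Matrix.fromBlocks_mulVec] at ha
      simp only [Sum.elim_comp_inl, Sum.elim_comp_inr] at ha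
      have h1 : A *ᵥ a + B *ᵥ x = 0 := by
        funext i; simpa using congrFun ha (Sum.inl i)
      have h2 : C *ᵥ a + D *ᵥ x = 0 := by
        funext i; simpa using congrFun ha (Sum.inr i)
      have h3 : B *ᵥ x = - (A *ᵥ a) := by rw [eq_neg_iff_add_eq_zero, add_comm]; exact h1
      rw [Matrix.sub_mulVec, ← Matrix.mulVec_mulVec, h3, Matrix.mulVec_neg, Matrix.mulVec_mulVec, c1,
        sub_neg_eq_add, add_comm]
      exact h2

theorem aux_LS (q n : ℕ) (s : ℕ → Matrix (Fin q) (Fin q) ℂ) (hH : (hank q n s).PosSemidef)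
    (j : ℕ) (hj : j ≤ n) :
    (LS q s j)ᴴ = LS q s j ∧ ∀ x : Fin q → ℂ, LS q s j *ᵥ x = 0 ↔
      ∃ u : Fin (n+1) × Fin q → ℂ, (∀ i b, j < i.val → u (i, b) = 0) ∧
        (∀ i b, i.val = j → u (i, b) = x b) ∧ hank q n s *ᵥ u = 0 := by
  cases j with
  | zero =>
    let e : Fin q → Fin (n+1) × Fin q := fun b => (0, b)
    have he : Function.Injective e := by
      intro a b hab
      simpa [e] using hab
    have hr : ∀ i, i ∉ Set.range e → 0 < i.1.val := by
      rintro ⟨i, b⟩ h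
      by_contra hc
      apply h
      refine ⟨b, ?_⟩
      have hi : i = 0 := Fin.ext (by simpa using hc)
      rw [hi]
    have hK : (hank q n s).submatrix e e = LS q s 0 := by
      ext a b; simp [hank, e, LS]
    rw [← hK]
    refine ⟨(hH.submatrix e).isHermitian, ?_⟩
    intro x
    constructor
    · intro h
      refine ⟨fun i => if i.1.val = 0 then x i.2 else 0, ?_, ?_, ?_⟩
      · intro i b hi
        exact if_neg (by simpa using hi.ne')
      · intro i b hi
        exact if_pos hi
      · rw [← aux_sub_ker _ hH e he]
        · exact h
        · intro i hi
          exact if_neg (hr i hi).ne'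
    · rintro ⟨u, h1, h2, h3⟩
      rw [← aux_sub_ker _ hH e he] at h3
      · convert h3 using 2
        funext b
        exact (h2 0 b rfl).symm
      · intro i hi
        exact h1 _ _ (hr i hi)
  | succ m =>
    let e : (Fin (m+1) × Fin q) ⊕ Fin q → Fin (n+1) × Fin q :=
      Sum.elim (fun p => (⟨p.1.val, by omega⟩, p.2)) (fun b => (⟨m+1, by omega⟩, b))
    have he : Function.Injective e := by
      rintro (⟨a, a'⟩ | a) (⟨b, b'⟩ | b) hab <;> simp [e] at hab ⊢
      · exact ⟨Fin.ext hab.1, hab.2⟩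
      · omega
      · omega
      · exact hab
    have hr : ∀ i, i ∉ Set.range e → m + 1 < i.1.val := by
      rintro ⟨i, b⟩ h
      by_contra hc
      apply h
      by_cases hi : i.val = m + 1
      · refine ⟨Sum.inr b, ?_⟩
        ext <;> simp [e, hi]
      · refine ⟨Sum.inl (⟨i.val, by simp at hc; omega⟩, b), ?_⟩
        ext <;> simp [e]
    have hK : (hank q n s).submatrix e e = Matrix.fromBlocks (hank q m s)
        (Matrix.of fun (j : Fin (m + 1) × Fin q) (b : Fin q) => s ((m + 1) + j.1.val) j.2 b)
        (Matrix.of fun (a : Fin q) (j : Fin (m + 1) × Fin q) => s ((m + 1) + j.1.val) a j.2)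
        (s (2 * (m + 1))) := by
      ext (⟨a, a'⟩ | a) (⟨b, b'⟩ | b) <;> simp [hank, e, add_comm, two_mul]
    have hP := hH.submatrix e
    rw [hK] at hP
    obtain ⟨g1, g2⟩ := aux_schur _ _ _ _ hP
    refine ⟨g1, ?_⟩
    intro x
    refine (g2 x).trans ?_
    rw [← hK]
    constructor
    · rintro ⟨a, ha⟩
      have hinr : Function.extend e (Sum.elim a x) 0 ∘ e = Sum.elim a x := by
        funext k
        exact he.extend_apply _ _ _
      refine ⟨Function.extend e (Sum.elim a x) 0, ?_, ?_, ?_⟩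
      · intro i b hi
        rw [Function.extend_apply']
        · rfl
        · rintro ⟨p | p, hp⟩
          · have := congrArg (fun t => t.1.val) hp
            simp [e] at this
            omega
          · have := congrArg (fun t => t.1.val) hp
            simp [e] at this
            omega
      · intro i b hi
        have : (i, b) = e (Sum.inr b) := by
          ext <;> simp [e, hi]
        rw [this, he.extend_apply]
        rfl
      · rw [← aux_sub_ker _ hH e he, hinr]
        · exact ha
        · intro i hi
          rw [Function.extend_apply' _ _ _ hi]
          rfl
    · rintro ⟨u, h1, h2, h3⟩
      rw [← aux_sub_ker _ hH e he] at h3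
      · refine ⟨u ∘ e ∘ Sum.inl, ?_⟩
        convert h3 using 2
        funext k
        cases k with
        | inl k => rfl
        | inr b => exact (h2 _ b rfl).symm
      · intro i hi
        exact h1 _ _ (hr i hi)

theorem aux_ker_mono (q n : ℕ) (α : ℝ) (s t : ℕ → Matrix (Fin q) (Fin q) ℂ)
    (hst : ∀ j ≤ 2 * n, t j = s j)
    (hH : (hank q n s).PosSemidef) (hS : (hank q n (sShift α t)).PosSemidef)
    (j : ℕ) (hj : j + 1 ≤ n) (x : Fin q → ℂ) (hx : LS q s j *ᵥ x = 0) :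
    LS q s (j+1) *ᵥ x = 0 := by
  rw [(aux_LS q n s hH j (by omega)).2] at hx
  rw [(aux_LS q n s hH (j+1) hj).2]
  obtain ⟨u, h1, h2, h3⟩ := hx
  have hW : hank q n (sShift α t) *ᵥ u = hank q n s *ᵥ (bshift q n *ᵥ u) := by
    have key : hank q n (sShift α t) *ᵥ u = (-(α : ℂ)) • (hank q n s *ᵥ u)
        + hank q n s *ᵥ (bshift q n *ᵥ u) := by
      funext ⟨i, b⟩
      simp only [Pi.add_apply, Pi.smul_apply, Matrix.mulVec, dotProduct, Fintype.sum_prod_type,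
        smul_eq_mul]
      have e3 : ∑ k : Fin (n+1), ∑ c, hank q n s (i, b) (k, c) * (∑ k', ∑ c',
          bshift q n (k, c) (k', c') * u (k', c'))
          = ∑ k : Fin n, ∑ c, t (i.val + k.val + 1) b c * u (k.castSucc, c) := by
        have e4 : ∀ k c, (∑ k', ∑ c', bshift q n (k, c) (k', c') * u (k', c'))
            = if k.val = 0 then 0 else u (⟨k.val - 1, by omega⟩, c) := by
          intro k c
          rw [← aux_Tvec]
          simp only [Matrix.mulVec, dotProduct, Fintype.sum_prod_type]
        simp only [e4]
        rw [Fin.sum_univ_succ]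
        simp only [Fin.val_zero, if_true, mul_zero, Finset.sum_const_zero, zero_add]
        refine Finset.sum_congr rfl fun k _ => Finset.sum_congr rfl fun c _ => ?_
        rw [hst _ (by omega)]
        simp [hank, add_assoc]
        left; rfl
      rw [e3, Fin.sum_univ_castSucc, Fin.sum_univ_castSucc]
      have hl : ∀ c, u (Fin.last n, c) = 0 := fun c => h1 _ _ (by simp; omega)
      simp only [hl, mul_zero, Finset.sum_const_zero, add_zero]
      rw [Finset.mul_sum, ← Finset.sum_add_distrib]
      refine Finset.sum_congr rfl fun k _ => ?_
      rw [Finset.mul_sum, ← Finset.sum_add_distrib]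
      refine Finset.sum_congr rfl fun c _ => ?_
      simp only [hank, sShift, Matrix.of_apply, Matrix.add_apply, Matrix.smul_apply, smul_eq_mul,
        Fin.val_castSucc]
      rw [hst (i.val + k.val) (by omega)]
      ring
    rw [key, h3, smul_zero, zero_add]
  refine ⟨bshift q n *ᵥ u, ?_, ?_, ?_⟩
  · intro i b hi
    rw [aux_Tvec, if_neg (by omega)]
    exact h1 _ _ (by simp; omega)
  · intro i b hi
    rw [aux_Tvec, if_neg (by omega)]
    exact h2 _ _ (by simp; omega)
  · rw [← hW]
    apply aux_psd _ hS
    rw [hW, Matrix.dotProduct_mulVec, ← hH.isHermitian.eq, ← Matrix.star_mulVec, h3, star_zero,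
      zero_dotProduct]

theorem aux_kerG (q n : ℕ) (s : ℕ → Matrix (Fin q) (Fin q) ℂ) (hH : (hank q n s).PosSemidef)
    (G : Matrix (Fin (n + 1) × Fin q) (Fin (n + 1) × Fin q) ℂ)
    (hG : IsRGI (hank q n s) G (Dsub q n s)) (x : Fin (n + 1) × Fin q → ℂ) :
    G *ᵥ x = 0 ↔ ∀ i : Fin (n+1), LS q s i.val *ᵥ (fun b => x (i, b)) = 0 := by
  rw [hG.2.2.2]
  have hL : (Ldiag q n s)ᴴ = Ldiag q n s := by
    ext ⟨i, a⟩ ⟨j, b⟩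
    simp only [Matrix.conjTranspose_apply, Ldiag, Matrix.of_apply]
    by_cases h : i = j
    · subst h
      simp only [if_true]
      have := (aux_LS q n s hH i.val (by omega)).1
      exact congrFun (congrFun this a) b
    · rw [if_neg h, if_neg (Ne.symm h), star_zero]
  have h1 : (∀ y ∈ Dsub q n s, star y ⬝ᵥ x = 0) ↔ Ldiag q n s *ᵥ x = 0 := by
    constructor
    · intro h
      have := h (Ldiag q n s *ᵥ (Ldiag q n s *ᵥ x)) ⟨_, rfl⟩
      rw [Matrix.star_mulVec, ← Matrix.dotProduct_mulVec, hL] at this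
      exact dotProduct_star_self_eq_zero.mp this
    · rintro h _ ⟨c, rfl⟩
      rw [Matrix.mulVecLin_apply, Matrix.star_mulVec, ← Matrix.dotProduct_mulVec, hL, h,
        dotProduct_zero]
  rw [h1]
  have h2 : ∀ i b, (Ldiag q n s *ᵥ x) (i, b) = (LS q s i.val *ᵥ (fun b => x (i, b))) b := by
    intro i b
    simp only [Matrix.mulVec, dotProduct, Fintype.sum_prod_type]
    rw [Finset.sum_eq_single i]
    · simp [Ldiag]
    · intro k _ hk
      simp [Ldiag, Ne.symm hk]
    · simp
  constructor
  · intro h i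
    funext b
    rw [← h2, h]; rfl
  · intro h
    funext ⟨i, b⟩
    rw [h2, h]; rfl

theorem aux_GT (q n : ℕ) (α : ℝ) (s t : ℕ → Matrix (Fin q) (Fin q) ℂ)
    (hst : ∀ j ≤ 2 * n, t j = s j)
    (hH : (hank q n s).PosSemidef) (hS : (hank q n (sShift α t)).PosSemidef)
    (G : Matrix (Fin (n + 1) × Fin q) (Fin (n + 1) × Fin q) ℂ)
    (hG : IsRGI (hank q n s) G (Dsub q n s)) (x : Fin (n + 1) × Fin q → ℂ)
    (hx : G *ᵥ x = 0) : G *ᵥ (bshift q n *ᵥ x) = 0 := by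
  rw [aux_kerG q n s hH G hG] at hx ⊢
  rintro ⟨i, hi⟩
  cases i with
  | zero =>
    have : (fun b => (bshift q n *ᵥ x) ((⟨0, hi⟩ : Fin (n+1)), b)) = 0 := by
      funext b; rw [aux_Tvec]; simp
    rw [this, Matrix.mulVec_zero]
  | succ i =>
    have : (fun b => (bshift q n *ᵥ x) ((⟨i+1, hi⟩ : Fin (n+1)), b))
        = fun b => x (⟨i, by omega⟩, b) := by
      funext b; rw [aux_Tvec]; simp
    rw [this]
    exact aux_ker_mono q n α s t hst hH hS i (by omega) _ (hx ⟨i, by omega⟩)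

theorem aux_GR (q n : ℕ) (α : ℝ) (s t : ℕ → Matrix (Fin q) (Fin q) ℂ)
    (hst : ∀ j ≤ 2 * n, t j = s j)
    (hH : (hank q n s).PosSemidef) (hS : (hank q n (sShift α t)).PosSemidef)
    (G : Matrix (Fin (n + 1) × Fin q) (Fin (n + 1) × Fin q) ℂ)
    (hG : IsRGI (hank q n s) G (Dsub q n s)) (a : ℂ) (x : Fin (n + 1) × Fin q → ℂ)
    (hx : G *ᵥ x = 0) : G *ᵥ (RT q n a *ᵥ x) = 0 := by
  obtain ⟨N, hN⟩ := aux_nilp q n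
  have hT : ∀ m, G *ᵥ (bshift q n ^ m *ᵥ x) = 0 := by
    intro m
    induction m with
    | zero => simpa using hx
    | succ m ih =>
      rw [pow_succ', ← Matrix.mulVec_mulVec]
      exact aux_GT q n α s t hst hH hS G hG _ ih
  have hR : RT q n a = 1 + a • (bshift q n * RT q n a) := by
    have := aux_RT_r q n a
    rw [Matrix.sub_mul, Matrix.one_mul, Matrix.smul_mul] at this
    exact sub_eq_iff_eq_add.mp this
  have hd : ∀ k m, m + k = N → G *ᵥ ((bshift q n ^ m * RT q n a) *ᵥ x) = 0 := by
    intro k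
    induction k with
    | zero =>
      intro m hm
      rw [add_zero] at hm
      subst hm
      rw [hN]; simp
    | succ k ih =>
      intro m hm
      have h1 := ih (m+1) (by omega)
      rw [hR, Matrix.mul_add, Matrix.mul_one, Matrix.mul_smul, ← Matrix.mul_assoc, ← pow_succ,
        Matrix.add_mulVec, Matrix.mulVec_add, hT, Matrix.smul_mulVec, Matrix.mulVec_smul, h1]
      simp
  simpa using hd N 0 (by omega)

theorem aux_BJ (q n : ℕ) (X : Matrix (Fin (n + 1) × Fin q) (Fin (n + 1) × Fin q) ℂ) :
    (Matrix.fromCols (1 : Matrix (Fin (n + 1) × Fin q) (Fin (n + 1) × Fin q) ℂ) X * kvq q n) * Jmat q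
      = Complex.I • (Matrix.fromCols X
        (-1 : Matrix (Fin (n + 1) × Fin q) (Fin (n + 1) × Fin q) ℂ) * kvq q n) := by
  rw [kvq, Jmat, Matrix.fromCols_mul_fromBlocks, Matrix.fromCols_mul_fromBlocks,
    Matrix.fromCols_mul_fromBlocks]
  ext i (j | j) <;> simp

theorem aux_AB (q n : ℕ) (X : Matrix (Fin (n + 1) × Fin q) (Fin (n + 1) × Fin q) ℂ) :
    (Matrix.fromCols X (-1 : Matrix (Fin (n + 1) × Fin q) (Fin (n + 1) × Fin q) ℂ) * kvq q n) *
    (Matrix.fromCols (1 : Matrix (Fin (n + 1) × Fin q) (Fin (n + 1) × Fin q) ℂ) X * kvq q n)ᴴ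
      = X * vq q n * (vq q n)ᴴ - vq q n * ((vq q n)ᴴ * Xᴴ) := by
  rw [kvq, Matrix.fromCols_mul_fromBlocks, Matrix.fromCols_mul_fromBlocks,
    Matrix.conjTranspose_fromCols_eq_fromRows_conjTranspose, Matrix.fromCols_mul_fromRows]
  simp [sub_eq_add_neg]

theorem aux_final {ι κ : Type*} [Fintype ι] [DecidableEq ι] [Fintype κ] [DecidableEq κ]
    (A B : Matrix ι κ ℂ) (J : Matrix κ κ ℂ) (E F W V : Matrix ι ι ℂ)
    (h1 : B * J = Complex.I • A) (h2 : J * Bᴴ = (-Complex.I) • Aᴴ) (h3 : A * Bᴴ = W)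
    (h4 : -E + F - E * W * F = V) :
    J - (1 + Aᴴ * E * B) * J * (1 + Bᴴ * F * A) = Complex.I • (Aᴴ * V * A) := by
  have e : (1 + Aᴴ * E * B) * J * (1 + Bᴴ * F * A)
      = J + Aᴴ * E * (B * J) + (J * Bᴴ) * F * A + Aᴴ * E * ((B * J) * Bᴴ) * F * A := by
    simp only [Matrix.add_mul, Matrix.mul_add, Matrix.one_mul, Matrix.mul_one, Matrix.mul_assoc]
    abel
  rw [e, h1, h2, Matrix.smul_mul Complex.I A, h3, ← h4]
  simp only [Matrix.mul_smul, Matrix.smul_mul, Matrix.mul_add, Matrix.add_mul, Matrix.mul_sub,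
    Matrix.sub_mul, Matrix.mul_neg, Matrix.neg_mul, Matrix.mul_assoc]
  module

/-- Lemma (ML28-1): the fundamental `J̃_q`-identity for the matrix polynomial `U_{n,α}`. -/
theorem J_identity_for_U
    (q : ℕ) (hq : 1 ≤ q) (α : ℝ) (n : ℕ) (s : ℕ → Matrix (Fin q) (Fin q) ℂ)
    (hK : ∃ t : ℕ → Matrix (Fin q) (Fin q) ℂ,
      (∀ j ≤ 2 * n, t j = s j) ∧
        (hank q n t).PosSemidef ∧ (hank q n (sShift α t)).PosSemidef)
    (G : Matrix (Fin (n + 1) × Fin q) (Fin (n + 1) × Fin q) ℂ)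
    (hG : IsRGI (hank q n s) G (Dsub q n s)) :
    ∀ z w : ℂ,
      Jmat q - Umat q n α s G z * Jmat q * (Umat q n α s G w)ᴴ =
        ((-Complex.I) * (z - conj w)) •
          ((kvq q n)ᴴ *
            (Matrix.fromCols (bshift q n * hank q n s)
              (-1 : Matrix (Fin (n + 1) × Fin q) (Fin (n + 1) × Fin q) ℂ))ᴴ * RTs q n z *
            G * (RTs q n w)ᴴ *
            Matrix.fromCols (bshift q n * hank q n s)
              (-1 : Matrix (Fin (n + 1) × Fin q) (Fin (n + 1) × Fin q) ℂ) *
            kvq q n) := by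
  intro z w
  obtain ⟨t, hst, hHt, hS⟩ := hK
  have hH : (hank q n s).PosSemidef := by
    have : hank q n s = hank q n t := by
      ext ⟨i, a⟩ ⟨j, b⟩
      simp only [hank, Matrix.of_apply]
      rw [hst _ (by omega)]
    rw [this]; exact hHt
  have hHh : (hank q n s)ᴴ = hank q n s := hH.isHermitian
  have hGh := aux_herm _ _ _ hHh hG
  have hRs : (RT q n (α : ℂ))ᴴ = RTs q n (α : ℂ) := by
    rw [← Matrix.conjTranspose_conjTranspose (RTs q n (α : ℂ)), aux_RTs, Complex.conj_ofReal]
  have k1 : G * (RT q n α * bshift q n) * hank q n s * G = G * (RT q n α * bshift q n) := by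
    have : G * (RT q n α * bshift q n) * (1 - hank q n s * G) = 0 := by
      apply Matrix.toLin'.injective
      apply LinearMap.ext
      intro c
      rw [Matrix.toLin'_apply, map_zero, LinearMap.zero_apply]
      simp only [← Matrix.mulVec_mulVec]
      have hc : G *ᵥ ((1 - hank q n s * G) *ᵥ c) = 0 := by
        rw [Matrix.mulVec_mulVec, Matrix.mul_sub, ← Matrix.mul_assoc, hG.2.1]; simp
      exact aux_GR q n α s t hst hH hS G hG _ _ (aux_GT q n α s t hst hH hS G hG _ hc)
    rw [Matrix.mul_sub, Matrix.mul_one, sub_eq_zero] at this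
    rw [Matrix.mul_assoc _ (hank q n s) G]
    exact this.symm
  have k2 : G * hank q n s * ((bshift q n)ᴴ * RTs q n α) * G = ((bshift q n)ᴴ * RTs q n α) * G := by
    have := congrArg Matrix.conjTranspose k1
    simpa only [Matrix.conjTranspose_mul, hGh, hHh, hRs, Matrix.mul_assoc] using this
  have hRw : (1 - conj w • bshift q n) * (RTs q n w)ᴴ = 1 := by
    rw [aux_RTs]; exact aux_RT_r q n _
  have hR2 : (1 - (α : ℂ) • (bshift q n)ᴴ) * RTs q n α = 1 := by
    have := congrArg Matrix.conjTranspose (aux_RT_l q n α)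
    rw [Matrix.conjTranspose_mul, hRs] at this
    simpa using this
  have core := aux_core (bshift q n) (hank q n s) G (RT q n α) (RTs q n α) (RTs q n z) (RTs q n w)ᴴ
    _ _ α z (conj w) (aux_RTs_l q n z) hRw (aux_RT_l q n α) hR2 rfl rfl k1 k2
  have hBJ := aux_BJ q n (bshift q n * hank q n s)
  have hJJ : (Jmat q)ᴴ = Jmat q := by
    rw [Jmat, Matrix.fromBlocks_conjTranspose]
    simp
  have hJB := congrArg Matrix.conjTranspose hBJ
  rw [Matrix.conjTranspose_mul, hJJ, Matrix.conjTranspose_smul] at hJB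
  have hAB := aux_AB q n (bshift q n * hank q n s)
  rw [Matrix.conjTranspose_mul (bshift q n), hHh, ← aux_lyap] at hAB
  have fin := aux_final _ _ _ _ _ _ _ hBJ (by simpa using hJB) hAB core
  have u1 : Umat q n α s G z = 1 + (Matrix.fromCols (bshift q n * hank q n s)
        (-1 : Matrix (Fin (n + 1) × Fin q) (Fin (n + 1) × Fin q) ℂ) * kvq q n)ᴴ *
        ((z - (α : ℂ)) • (RTs q n z * G * RT q n α)) *
        (Matrix.fromCols (1 : Matrix (Fin (n + 1) × Fin q) (Fin (n + 1) × Fin q) ℂ)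
        (bshift q n * hank q n s) * kvq q n) := by
    rw [Umat, Matrix.conjTranspose_mul]
    simp only [Matrix.mul_smul, Matrix.smul_mul, Matrix.mul_assoc]
  have u2 : (Umat q n α s G w)ᴴ = 1 +
        (Matrix.fromCols (1 : Matrix (Fin (n + 1) × Fin q) (Fin (n + 1) × Fin q) ℂ)
        (bshift q n * hank q n s) * kvq q n)ᴴ *
        ((conj w - (α : ℂ)) • (RTs q n α * G * (RTs q n w)ᴴ)) *
        (Matrix.fromCols (bshift q n * hank q n s)
        (-1 : Matrix (Fin (n + 1) × Fin q) (Fin (n + 1) × Fin q) ℂ) * kvq q n) := by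
    rw [Umat, Matrix.conjTranspose_add, Matrix.conjTranspose_smul]
    simp only [Matrix.conjTranspose_mul, Matrix.conjTranspose_conjTranspose, hGh, hRs,
      Matrix.conjTranspose_one, star_sub, Complex.star_def, Complex.conj_ofReal,
      Matrix.mul_smul, Matrix.smul_mul, Matrix.mul_assoc]
  rw [u1, u2, fin, Matrix.conjTranspose_mul]
  simp only [Matrix.mul_smul, Matrix.smul_mul, Matrix.mul_neg, Matrix.neg_mul, Matrix.mul_assoc,
    smul_neg, smul_smul, neg_mul, neg_smul]
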